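/- arXiv:1707.08759 — 11 statements merged into one kernel-verified Lean document; each statement's English description precedes it below -/
import Mathlib

section
/- For every coalition C and every formula φ ∈ Φ, the formula H_C φ → K_C H_C φ is provable: ⊢ H_C φ → K_C H_C φ (strategic positive introspection is derivable). -/
/-- An epistemic transition system over a set of agents `A` and
propositional variables `Var`. -/
structure ETS (A : Type) (Var : Type) where
  W : Type
  Sim : A → W → W → Prop
  sim_equiv : ∀ a, Equivalence (Sim a)
  V : Type
  V_nonempty : Nonempty V
  M : W → (A → V) → W → Prop
  M_serial : ∀ w s, ∃ w', M w s w'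
  pi : Var → Set W

/-- Formulas of the language Φ. -/
inductive Formula (A Var : Type) : Type
  | var : Var → Formula A Var
  | neg : Formula A Var → Formula A Var
  | imp : Formula A Var → Formula A Var → Formula A Var
  | know : Set A → Formula A Var → Formula A Var
  | strat : Set A → Formula A Var → Formula A Var
  | how : Set A → Formula A Var → Formula A Var

variable {A Var : Type}

/-- Indistinguishability by a coalition `C`. -/
def ETS.simC (T : ETS A Var) (C : Set A) (w₁ w₂ : T.W) : Prop :=
  ∀ a ∈ C, T.Sim a w₁ w₂

/-- `T.trans C s w u` : a transition from `w` to `u` is consistent with the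
strategy profile `s` of coalition `C`. -/
def ETS.trans (T : ETS A Var) (C : Set A) (s : C → T.V) (w u : T.W) : Prop :=
  ∃ s' : A → T.V, (∀ (a : A) (h : a ∈ C), s' a = s ⟨a, h⟩) ∧ T.M w s' u

/-- Satisfaction relation `w ⊨ φ`. -/
def ETS.Sat (T : ETS A Var) : T.W → Formula A Var → Prop
  | w, Formula.var p => w ∈ T.pi p
  | w, Formula.neg φ => ¬ T.Sat w φ
  | w, Formula.imp φ ψ => T.Sat w φ → T.Sat w ψ
  | w, Formula.know C φ => ∀ w', T.simC C w w' → T.Sat w' φ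
  | w, Formula.strat C φ => ∃ s : C → T.V, ∀ w', T.trans C s w w' → T.Sat w' φ
  | w, Formula.how C φ =>
      ∃ s : C → T.V, ∀ w' w'', T.simC C w w' → T.trans C s w' w'' → T.Sat w'' φ
/-- `⊥` abbreviates `¬(p → p)` for a fixed propositional variable. -/
def Formula.bot {A : Type} : Formula A ℕ := .neg (.imp (.var 0) (.var 0))

/-- Propositional tautologies in the language Φ (modal subformulas
are treated as atoms). -/
def Tautology {A Var : Type} (φ : Formula A Var) : Prop :=
  ∀ v : Formula A Var → Prop,
    (∀ ψ, v (.neg ψ) ↔ ¬ v ψ) →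
    (∀ ψ χ, v (.imp ψ χ) ↔ (v ψ → v χ)) →
    v φ

/-- The proof system `⊢`. -/
inductive Prov {A : Type} : Formula A ℕ → Prop
  | taut {φ} : Tautology φ → Prov φ
  | truth {C φ} : Prov (.imp (.know C φ) φ)
  | negIntro {C φ} : Prov (.imp (.neg (.know C φ)) (.know C (.neg (.know C φ))))
  | distrib {C φ ψ} : Prov (.imp (.know C (.imp φ ψ)) (.imp (.know C φ) (.know C ψ)))
  | mono {C D : Set A} {φ} : C ⊆ D → Prov (.imp (.know C φ) (.know D φ))
  | coop {C D : Set A} {φ ψ} : C ∩ D = ∅ →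
      Prov (.imp (.strat C (.imp φ ψ)) (.imp (.strat D φ) (.strat (C ∪ D) ψ)))
  | stratNegIntro {C φ} : Prov (.imp (.neg (.how C φ)) (.know C (.neg (.how C φ))))
  | epCoop {C D : Set A} {φ ψ} : C ∩ D = ∅ →
      Prov (.imp (.how C (.imp φ ψ)) (.imp (.how D φ) (.how (C ∪ D) ψ)))
  | stratTruth {C φ} : Prov (.imp (.how C φ) (.strat C φ))
  | epDet {C φ ψ} :
      Prov (.imp (.how C (.imp φ ψ))
        (.imp (.know C (.strat (∅ : Set A) φ)) (.how C ψ)))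
  | emptyCoal {φ} : Prov (.imp (.know (∅ : Set A) φ) (.how (∅ : Set A) φ))
  | nonterm {C} : Prov (.neg (.strat C Formula.bot))
  | mp {φ ψ} : Prov (.imp φ ψ) → Prov φ → Prov ψ
  | nec {C φ} : Prov φ → Prov (.know C φ)
  | stratNec {C φ} : Prov φ → Prov (.how C φ)

/-- strategic positive introspection is derivable:
`⊢ H_C φ → K_C H_C φ`. -/
theorem strategic_positive_introspection {A : Type} [Fintype A]
    (C : Set A) (φ : Formula A ℕ) :
    Prov (.imp (.how C φ) (.know C (.how C φ))) := by 
  have hneg : Prov (.imp (.neg (.know C (.neg (.how C φ)))) (.how C φ)) := by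
    refine .mp (.taut ?_) (Prov.stratNegIntro (C := C) (φ := φ))
    intro v hn hi
    simp only [hn, hi]
    tauto
  have h2 := Prov.mp Prov.distrib (Prov.nec (C := C) hneg)
  have h3 := Prov.negIntro (C := C) (φ := .neg (.how C φ))
  have h4 := Prov.truth (C := C) (φ := .neg (.how C φ))
  refine .mp (.mp (.mp (.taut ?_) h2) h3) h4
  intro v hn hi
  simp only [hn, hi]
  tauto
end

section
/- For every coalition C and every formula φ ∈ Φ, the formula H_C φ → K_C S_C φ is provable: ⊢ H_C φ → K_C S_C φ. -/
variable {A Var : Type}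

theorem Prov.syl {A : Type} {a b c : Formula A ℕ} (h1 : Prov (.imp a b)) (h2 : Prov (.imp b c)) :
    Prov (.imp a c) := by
  refine .mp (.mp (.taut (φ := .imp (.imp a b) (.imp (.imp b c) (.imp a c))) ?_) h1) h2
  intro v hn hi
  simp only [hi]
  tauto

theorem Prov.contra {A : Type} {a b : Formula A ℕ} (h1 : Prov (.imp a (.neg b))) :
    Prov (.imp b (.neg a)) := by
  refine .mp (.taut (φ := .imp (.imp a (.neg b)) (.imp b (.neg a))) ?_) h1
  intro v hn hi
  simp only [hi, hn]
  tauto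

theorem Prov.contra2 {A : Type} {a b : Formula A ℕ} (h1 : Prov (.imp (.neg a) b)) :
    Prov (.imp (.neg b) a) := by
  refine .mp (.taut (φ := .imp (.imp (.neg a) b) (.imp (.neg b) a)) ?_) h1
  intro v hn hi
  simp only [hi, hn]
  tauto

theorem Prov.kmono {A : Type} {C : Set A} {a b : Formula A ℕ} (h1 : Prov (.imp a b)) :
    Prov (.imp (.know C a) (.know C b)) := .mp .distrib (.nec h1)

/-- `⊢ H_C φ → K_C S_C φ`. -/
theorem howImpKnowStrat {A : Type} [Fintype A] (C : Set A) (φ : Formula A ℕ) :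
    Prov (.imp (.how C φ) (.know C (.strat C φ))) := 
  (((Prov.contra .truth).syl .negIntro).syl (Prov.kmono (Prov.contra2 .stratNegIntro))).syl
    (Prov.kmono .stratTruth)
end

section
/- For all coalitions C and D with C ⊆ D and every formula φ ∈ Φ, the formula H_C φ → H_D φ is provable: ⊢ H_C φ → H_D φ. -/
variable {A Var : Type}

/-- `⊢ H_C φ → H_D φ` whenever `C ⊆ D`. -/
theorem how_monotone {A : Type} [Fintype A] (C D : Set A) (hCD : C ⊆ D)
    (φ : Formula A ℕ) :
    Prov (.imp (.how C φ) (.how D φ)) := by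
  have h1 : Prov (.how (D \ C) (.imp φ φ)) :=
    Prov.stratNec (Prov.taut (fun v _ h => (h φ φ).2 id))
  have h2 := Prov.epCoop (φ := φ) (ψ := φ) (Set.diff_inter_self (a := C) (b := D))
  rw [Set.diff_union_of_subset hCD] at h2
  exact Prov.mp h2 h1
end

section
/- Soundness: for every formula φ ∈ Φ, if ⊢ φ, then w ⊨ φ for every epistemic state w of every epistemic transition system. -/
variable {A Var : Type}

/-- Indistinguishability by a coalition is reflexive. -/
theorem ETS.simC_refl (T : ETS A Var) (C : Set A) (w : T.W) : T.simC C w w :=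
  fun a _ => (T.sim_equiv a).refl w

theorem ETS.simC_symm (T : ETS A Var) {C : Set A} {w u : T.W} (h : T.simC C w u) :
    T.simC C u w :=
  fun a ha => (T.sim_equiv a).symm (h a ha)

theorem ETS.simC_trans (T : ETS A Var) {C : Set A} {w u v : T.W} (h : T.simC C w u)
    (h' : T.simC C u v) : T.simC C w v :=
  fun a ha => (T.sim_equiv a).trans (h a ha) (h' a ha)

theorem ETS.simC_mono (T : ETS A Var) {C D : Set A} (hCD : C ⊆ D) {w u : T.W}
    (h : T.simC D w u) : T.simC C w u :=
  fun a ha => h a (hCD ha)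

/-- Profiles of disjoint coalitions can be merged. -/
theorem ETS.exists_merge (T : ETS A Var) {C D : Set A} (hCD : C ∩ D = ∅)
    (s : C → T.V) (t : D → T.V) :
    ∃ r : (C ∪ D : Set A) → T.V, ∀ w u, T.trans (C ∪ D) r w u →
      T.trans C s w u ∧ T.trans D t w u := by
  classical
  refine ⟨fun a => if h : a.1 ∈ C then s ⟨a.1, h⟩
    else t ⟨a.1, a.2.resolve_left h⟩, ?_⟩
  rintro w u ⟨r, hr, hM⟩
  refine ⟨⟨r, fun a ha => ?_, hM⟩, ⟨r, fun a ha => ?_, hM⟩⟩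
  · rw [hr a (Or.inl ha)]
    simp [ha]
  · have hn : a ∉ C := fun hc => by
      have : a ∈ C ∩ D := ⟨hc, ha⟩
      simp [hCD] at this
    rw [hr a (Or.inr ha)]
    simp [hn]

/-- Every profile of a coalition leads somewhere. -/
theorem ETS.exists_trans (T : ETS A Var) (C : Set A) (s : C → T.V) (w : T.W) :
    ∃ u, T.trans C s w u := by
  classical
  obtain ⟨v⟩ := T.V_nonempty
  obtain ⟨u, hu⟩ := T.M_serial w (fun a => if h : a ∈ C then s ⟨a, h⟩ else v)
  exact ⟨u, _, fun a h => by simp [h], hu⟩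

/-- Soundness: if `⊢ φ`, then `w ⊨ φ` in every state `w` of
every epistemic transition system. -/
theorem soundness {A : Type} [Fintype A] (φ : Formula A ℕ) (h : Prov φ) :
    ∀ (T : ETS A ℕ) (w : T.W), T.Sat w φ := by
  intro T
  obtain ⟨v⟩ := T.V_nonempty
  induction h with
  | taut h =>
    intro w
    exact h (fun ψ => T.Sat w ψ) (fun ψ => by simp [ETS.Sat]) (fun ψ χ => by simp [ETS.Sat])
  | truth =>
    intro w
    simp only [ETS.Sat]
    exact fun h => h w (T.simC_refl _ w)
  | negIntro =>
    intro w
    simp only [ETS.Sat]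
    exact fun h u hu h' => h fun x hx => h' x (T.simC_trans (T.simC_symm hu) hx)
  | distrib =>
    intro w
    simp only [ETS.Sat]
    exact fun h h' u hu => h u hu (h' u hu)
  | mono hCD =>
    intro w
    simp only [ETS.Sat]
    exact fun h u hu => h u (T.simC_mono hCD hu)
  | coop hCD =>
    intro w
    simp only [ETS.Sat]
    rintro ⟨s, hs⟩ ⟨t, ht⟩
    obtain ⟨r, hr⟩ := T.exists_merge hCD s t
    exact ⟨r, fun u hu => hs u (hr w u hu).1 (ht u (hr w u hu).2)⟩
  | stratNegIntro =>
    intro w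
    simp only [ETS.Sat]
    rintro h u hu ⟨s, hs⟩
    exact h ⟨s, fun x y hx hy => hs x y (T.simC_trans (T.simC_symm hu) hx) hy⟩
  | epCoop hCD =>
    intro w
    simp only [ETS.Sat]
    rintro ⟨s, hs⟩ ⟨t, ht⟩
    obtain ⟨r, hr⟩ := T.exists_merge hCD s t
    exact ⟨r, fun x u hx hu =>
      hs x u (T.simC_mono Set.subset_union_left hx) (hr x u hu).1
        (ht x u (T.simC_mono Set.subset_union_right hx) (hr x u hu).2)⟩
  | stratTruth =>
    intro w
    simp only [ETS.Sat]
    rintro ⟨s, hs⟩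
    exact ⟨s, fun u hu => hs w u (T.simC_refl _ w) hu⟩
  | epDet =>
    intro w
    simp only [ETS.Sat]
    rintro ⟨s, hs⟩ h
    refine ⟨s, fun x u hx hu => hs x u hx hu ?_⟩
    obtain ⟨t, ht⟩ := h x hx
    obtain ⟨r, _, hM⟩ := hu
    exact ht u ⟨r, fun a ha => absurd ha (Set.notMem_empty a), hM⟩
  | emptyCoal =>
    intro w
    simp only [ETS.Sat]
    exact fun h => ⟨fun _ => v, fun x u _ _ => h u fun a ha => absurd ha (Set.notMem_empty a)⟩
  | nonterm =>
    intro w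
    simp only [ETS.Sat, Formula.bot]
    rintro ⟨s, hs⟩
    obtain ⟨u, hu⟩ := T.exists_trans _ s w
    exact hs u hu id
  | mp _ _ ih₁ ih₂ =>
    intro w
    have h := ih₁ w
    simp only [ETS.Sat] at h
    exact h (ih₂ w)
  | nec _ ih =>
    intro w
    simp only [ETS.Sat]
    exact fun u _ => ih u
  | stratNec _ ih =>
    intro w
    simp only [ETS.Sat]
    exact ⟨fun _ => v, fun _ u _ _ => ih u⟩
end

section
/- Completeness: for every formula φ ∈ Φ, if w ⊨ φ for every epistemic state w of every epistemic transition system, then ⊢ φ. -/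
variable {A Var : Type}

namespace KH

abbrev Fm (A : Type) := Formula A ℕ

/-- Iterated implication. -/
def imps {A : Type} : List (Fm A) → Fm A → Fm A
  | [], φ => φ
  | ψ :: L, φ => .imp ψ (imps L φ)

theorem imps_val {A : Type} (v : Fm A → Prop)
    (hi : ∀ ψ χ, v (.imp ψ χ) ↔ (v ψ → v χ)) (L : List (Fm A)) (φ : Fm A) :
    v (imps L φ) ↔ ((∀ x ∈ L, v x) → v φ) := by
  induction L with
  | nil => simp [imps]
  | cons a L ih => simp [imps, hi, ih]

/-- Derivability from a set of hypotheses. -/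
def Der {A : Type} (Γ : Set (Fm A)) (φ : Fm A) : Prop :=
  ∃ L : List (Fm A), (∀ x ∈ L, x ∈ Γ) ∧ Prov (imps L φ)

theorem Der.hyp {A : Type} {Γ : Set (Fm A)} {φ : Fm A} (h : φ ∈ Γ) : Der Γ φ :=
  ⟨[φ], by simpa using h, Prov.taut (by intro v hn hi; simp [imps, hi])⟩

theorem Der.prov {A : Type} {Γ : Set (Fm A)} {φ : Fm A} (h : Prov φ) : Der Γ φ :=
  ⟨[], by simp, h⟩

theorem Der.mp {A : Type} {Γ : Set (Fm A)} {φ ψ : Fm A} (h1 : Der Γ (.imp φ ψ))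
    (h2 : Der Γ φ) : Der Γ ψ := by
  obtain ⟨L1, a1, b1⟩ := h1
  obtain ⟨L2, a2, b2⟩ := h2
  refine ⟨L1 ++ L2, ?_, ?_⟩
  · intro x hx
    rcases List.mem_append.1 hx with h | h
    · exact a1 x h
    · exact a2 x h
  · refine Prov.mp (Prov.mp (Prov.taut ?_) b1) b2
    intro v hn hi
    simp only [hi, imps_val v hi, List.mem_append]
    intro p q r
    exact p (fun x hx => r x (Or.inl hx)) (q (fun x hx => r x (Or.inr hx)))

theorem Der.ded {A : Type} {Γ : Set (Fm A)} {φ ψ : Fm A} (h : Der (insert ψ Γ) φ) :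
    Der Γ (.imp ψ φ) := by
  classical
  obtain ⟨L, a, b⟩ := h
  refine ⟨L.filter (fun x => x ≠ ψ), ?_, ?_⟩
  · intro x hx
    simp only [List.mem_filter, decide_eq_true_eq] at hx
    rcases a x hx.1 with h | h
    · exact absurd h hx.2
    · exact h
  · refine Prov.mp (Prov.taut ?_) b
    intro v hn hi
    simp only [hi, imps_val v hi, List.mem_filter, decide_eq_true_eq]
    intro p q r
    apply p
    intro x hx
    by_cases hxp : x = ψ
    · rw [hxp]; exact r
    · exact q x ⟨hx, hxp⟩

/-- Maximal consistent sets. -/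
structure MCS (A : Type) where
  car : Set (Fm A)
  thm : ∀ {φ}, Prov φ → φ ∈ car
  imp : ∀ φ ψ, Formula.imp φ ψ ∈ car ↔ (φ ∈ car → ψ ∈ car)
  neg : ∀ φ, Formula.neg φ ∈ car ↔ ¬ φ ∈ car

theorem lindenbaum {A : Type} {Γ : Set (Fm A)} {φ : Fm A} (h : ¬ Der Γ φ) :
    ∃ X : MCS A, Γ ⊆ X.car ∧ φ ∉ X.car := by
  obtain ⟨X, hΓX, hX⟩ := zorn_subset_nonempty {X : Set (Fm A) | ¬ Der X φ} (by
    intro c hc hch hne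
    refine ⟨⋃₀ c, ?_, fun s hs => Set.subset_sUnion_of_mem hs⟩
    rintro ⟨L, a, b⟩
    have : ∃ s ∈ c, ∀ x ∈ L, x ∈ s := by
      clear b
      induction L with
      | nil => obtain ⟨s, hs⟩ := hne; exact ⟨s, hs, by simp⟩
      | cons y L ih =>
        obtain ⟨s, hs, h1⟩ := ih (fun x hx => a x (List.mem_cons_of_mem _ hx))
        obtain ⟨t, ht, h2⟩ := a y List.mem_cons_self
        rcases hch.total hs ht with hst | hts
        · refine ⟨t, ht, ?_⟩
          intro x hx
          rcases List.mem_cons.1 hx with rfl | hx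
          · exact h2
          · exact hst (h1 x hx)
        · refine ⟨s, hs, ?_⟩
          intro x hx
          rcases List.mem_cons.1 hx with rfl | hx
          · exact hts h2
          · exact h1 x hx
    obtain ⟨s, hs, h1⟩ := this
    exact hc hs ⟨L, h1, b⟩) Γ h
  have hnd : ¬ Der X φ := hX.prop
  have hφ : φ ∉ X := fun h => hnd (Der.hyp h)
  have hmax : ∀ ψ, ψ ∉ X → Der X (.imp ψ φ) := by
    intro ψ hψ
    by_contra hc
    have : ¬ Der (insert ψ X) φ := fun h => hc h.ded
    exact hψ (hX.le_of_ge this (Set.subset_insert _ _) (Set.mem_insert _ _))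
  have hcl : ∀ ψ, Der X ψ → ψ ∈ X := by
    intro ψ hψ
    by_contra hc
    exact hnd ((hmax ψ hc).mp hψ)
  have t : ∀ {ψ : Fm A}, Tautology ψ → Der X ψ := fun h => Der.prov (Prov.taut h)
  have hneg : ∀ ψ, Formula.neg ψ ∈ X ↔ ¬ ψ ∈ X := by
    intro ψ
    constructor
    · intro h1 h2
      refine hnd (((t (ψ := .imp (.neg ψ) (.imp ψ φ)) ?_).mp (Der.hyp h1)).mp (Der.hyp h2))
      intro v hn hi
      simp only [hn, hi]; tauto
    · intro h1
      by_contra h2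
      refine hnd (((t (ψ := .imp (.imp ψ φ) (.imp (.imp (.neg ψ) φ) φ)) ?_).mp
        (hmax _ h1)).mp (hmax _ h2))
      intro v hn hi
      simp only [hn, hi]; tauto
  refine ⟨⟨X, fun h => hcl _ (Der.prov h), ?_, hneg⟩, hΓX, hφ⟩
  intro ψ χ
  constructor
  · intro h1 h2
    exact hcl _ ((Der.hyp h1).mp (Der.hyp h2))
  · intro h1
    apply hcl
    by_cases h2 : ψ ∈ X
    · refine (t (ψ := .imp χ (.imp ψ χ)) ?_).mp (Der.hyp (h1 h2))
      intro v hn hi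
      simp only [hi]; tauto
    · refine (t (ψ := .imp (.neg ψ) (.imp ψ χ)) ?_).mp (Der.hyp ((hneg _).2 h2))
      intro v hn hi
      simp only [hn, hi]; tauto

namespace MCS
variable {A : Type} (X : MCS A)

theorem mp' {φ ψ : Fm A} (h : Prov (.imp φ ψ)) (h2 : φ ∈ X.car) : ψ ∈ X.car :=
  (X.imp _ _).1 (X.thm h) h2

theorem imps_mem (L : List (Fm A)) (φ : Fm A) :
    imps L φ ∈ X.car ↔ ((∀ x ∈ L, x ∈ X.car) → φ ∈ X.car) :=
  imps_val (fun ψ => ψ ∈ X.car) X.imp L φ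

theorem K_mono {C : Set A} {φ ψ : Fm A} (h : Prov (.imp φ ψ)) (hk : .know C φ ∈ X.car) :
    .know C ψ ∈ X.car :=
  (X.imp _ _).1 (X.mp' Prov.distrib (X.thm (Prov.nec h))) hk

/-- positive introspection from a negative introspection instance -/
theorem posIntro {C : Set A} {χ : Fm A} (h : Prov (.imp (.neg χ) (.know C (.neg χ))))
    (hx : χ ∈ X.car) : .know C χ ∈ X.car := by
  have h1 : Formula.neg (.know C (.neg χ)) ∈ X.car := by
    rw [X.neg]
    intro h2
    have := X.mp' Prov.truth h2
    rw [X.neg] at this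
    exact this hx
  have h2 := X.mp' Prov.negIntro h1
  refine X.K_mono (Prov.mp (Prov.taut ?_) h) h2
  intro v hn hi
  simp only [hn, hi]; tauto

theorem K_ext {C : Set A} {φ : Fm A} (h : Formula.know C φ ∉ X.car) :
    ∃ Y : MCS A, (∀ χ, .know C χ ∈ X.car → χ ∈ Y.car) ∧ φ ∉ Y.car := by
  have : ¬ Der {χ | Formula.know C χ ∈ X.car} φ := by
    rintro ⟨L, a, b⟩
    apply h
    have h0 : Formula.know C (imps L φ) ∈ X.car := X.thm (Prov.nec b)
    clear b h
    induction L with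
    | nil => exact h0
    | cons y L ih =>
      apply ih (fun x hx => a x (List.mem_cons_of_mem _ hx))
      exact (X.imp _ _).1 (X.mp' Prov.distrib h0) (a y List.mem_cons_self)
  obtain ⟨Y, h1, h2⟩ := lindenbaum this
  exact ⟨Y, fun χ hχ => h1 hχ, h2⟩

/-- closure of a mcs under a generic strategic modality -/
structure Box (X : MCS A) (box : Set A → Fm A → Fm A) : Prop where
  nec : ∀ C φ, Prov φ → box C φ ∈ X.car
  coop : ∀ C D φ ψ, C ∩ D = ∅ → box C (.imp φ ψ) ∈ X.car → box D φ ∈ X.car →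
    box (C ∪ D) ψ ∈ X.car

theorem boxS : Box X Formula.strat where
  nec C φ h := X.mp' Prov.stratTruth (X.thm (Prov.stratNec h))
  coop C D φ ψ h h1 h2 := (X.imp _ _).1 (X.mp' (Prov.coop h) h1) h2

theorem boxH : Box X Formula.how where
  nec C φ h := X.thm (Prov.stratNec h)
  coop C D φ ψ h h1 h2 := (X.imp _ _).1 (X.mp' (Prov.epCoop h) h1) h2

variable {X}

theorem Box.mono {box : Set A → Fm A → Fm A} (B : Box X box) {C D : Set A} (h : C ⊆ D)
    {φ : Fm A} (hφ : box C φ ∈ X.car) : box D φ ∈ X.car := by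
  have h1 : box (D \ C) (.imp φ φ) ∈ X.car := B.nec _ _ (Prov.taut (by
    intro v hn hi; simp only [hi]; tauto))
  have := B.coop _ _ _ _ (by simp) h1 hφ
  rwa [Set.sdiff_union_of_subset h] at this

theorem Box.list {box : Set A → Fm A → Fm A} (B : Box X box) {C : Set A} {φ : Fm A}
    (L : List (Set A × Fm A)) :
    ∀ (E : Set A), E ⊆ C → L.Pairwise (fun p q => Disjoint p.1 q.1) →
    (∀ p ∈ L, p.1 ⊆ C ∧ box p.1 p.2 ∈ X.car ∧ Disjoint E p.1) →
    box E (imps (L.map Prod.snd) φ) ∈ X.car → box C φ ∈ X.car := by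
  induction L with
  | nil => intro E hE _ _ h; exact B.mono hE h
  | cons p L ih =>
    intro E hE hp hL h
    rw [List.pairwise_cons] at hp
    have hp0 := hL p List.mem_cons_self
    refine ih (E ∪ p.1) (Set.union_subset hE hp0.1) hp.2 ?_ ?_
    · intro q hq
      have := hL q (List.mem_cons_of_mem _ hq)
      exact ⟨this.1, this.2.1, Set.disjoint_union_left.2 ⟨this.2.2, hp.1 q hq⟩⟩
    · exact B.coop _ _ _ _ hp0.2.2.inter_eq h hp0.2.1

variable (X)

theorem S_ext {Θ : Fm A} (h : Formula.strat ∅ Θ ∉ X.car) :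
    ∃ Z : MCS A, (∀ χ, .strat ∅ χ ∈ X.car → χ ∈ Z.car) ∧ Θ ∉ Z.car := by
  have : ¬ Der {χ | Formula.strat ∅ χ ∈ X.car} Θ := by
    rintro ⟨L, a, b⟩
    apply h
    have h0 : Formula.strat ∅ (imps L Θ) ∈ X.car := (boxS X).nec _ _ b
    clear b h
    induction L with
    | nil => exact h0
    | cons y L ih =>
      apply ih (fun x hx => a x (List.mem_cons_of_mem _ hx))
      have := (boxS X).coop _ _ _ _ (by simp) h0 (a y List.mem_cons_self)
      simpa using this
  obtain ⟨Y, h1, h2⟩ := lindenbaum this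
  exact ⟨Y, fun χ hχ => h1 hχ, h2⟩

end MCS

/-- Raw nodes of the tree. -/
abbrev Node (A : Type) := List (Set A × MCS A × ℕ)

section
variable {A : Type} (X₀ : MCS A)

def hd : Node A → MCS A
  | [] => X₀
  | e :: _ => e.2.1

def Valid : Node A → Prop
  | [] => True
  | e :: l => Valid l ∧ ∀ φ, .know e.1 φ ∈ (hd X₀ l).car → φ ∈ e.2.1.car

open Classical in
/-- Strip the final edges whose label includes `C`. -/
noncomputable def strip (C : Set A) : Node A → Node A
  | [] => []
  | e :: l => if C ⊆ e.1 then strip C l else e :: l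

theorem strip_suffix (C : Set A) (l : Node A) : strip C l <:+ l := by
  induction l with
  | nil => simp [strip]
  | cons e l ih =>
    simp only [strip]
    split_ifs
    · exact ih.trans (List.suffix_cons _ _)
    · exact List.suffix_rfl

theorem strip_suffix_strip {C : Set A} {a : A} (ha : a ∈ C) (l : Node A) :
    strip {a} l <:+ strip C l := by
  induction l with
  | nil => simp [strip]
  | cons e l ih =>
    by_cases h : C ⊆ e.1
    · have h' : ({a} : Set A) ⊆ e.1 := by simpa using h ha
      simpa [strip, h, h'] using ih
    · have := strip_suffix {a} (e :: l)
      simpa [strip, h] using this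

theorem strip_eq_some {C : Set A} (hC : C.Nonempty) (l : Node A) :
    ∃ a ∈ C, strip {a} l = strip C l := by
  induction l with
  | nil => obtain ⟨a, ha⟩ := hC; exact ⟨a, ha, by simp [strip]⟩
  | cons e l ih =>
    by_cases h : C ⊆ e.1
    · obtain ⟨a, ha, h1⟩ := ih
      have h' : ({a} : Set A) ⊆ e.1 := by simpa using h ha
      refine ⟨a, ha, ?_⟩
      simp only [strip, if_pos h, if_pos h', h1]
    · obtain ⟨a, ha, h1⟩ := Set.not_subset.1 h
      have h' : ¬ ({a} : Set A) ⊆ e.1 := by simpa using h1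
      exact ⟨a, ha, by simp only [strip, if_neg h, if_neg h']⟩

theorem strip_empty (l : Node A) : strip (∅ : Set A) l = [] := by
  induction l with
  | nil => simp [strip]
  | cons e l ih => simpa [strip] using ih

theorem strip_eq {C : Set A} {l l' : Node A}
    (h : ∀ a ∈ C, strip {a} l = strip {a} l') : strip C l = strip C l' := by
  rcases C.eq_empty_or_nonempty with rfl | hC
  · rw [strip_empty, strip_empty]
  · have key : ∀ {l l' : Node A}, (∀ a ∈ C, strip {a} l = strip {a} l') →
        strip C l <:+ strip C l' := by
      intro l l' h
      obtain ⟨a, ha, h1⟩ := strip_eq_some hC l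
      rw [← h1, h a ha]
      exact strip_suffix_strip ha l'
    have h1 := key h
    have h2 := key (fun a ha => (h a ha).symm)
    exact h1.eq_of_length_le h2.length_le

theorem K_strip {C : Set A} {φ : Fm A} (l : Node A) (hl : Valid X₀ l) :
    .know C φ ∈ (hd X₀ l).car ↔ .know C φ ∈ (hd X₀ (strip C l)).car := by
  induction l with
  | nil => simp [strip]
  | cons e l ih =>
    by_cases h : C ⊆ e.1
    · simp only [strip, if_pos h]
      rw [← ih hl.1]
      constructor
      · intro h1
        by_contra h2
        rw [← (hd X₀ l).neg] at h2
        have h3 := (hd X₀ l).mp' (Prov.mono h) ((hd X₀ l).mp' Prov.negIntro h2)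
        have h4 := hl.2 _ h3
        rw [MCS.neg] at h4
        exact h4 h1
      · intro h1
        have h3 := (hd X₀ l).mp' (Prov.mono h) ((hd X₀ l).posIntro Prov.negIntro h1)
        exact hl.2 _ h3
    · simp only [strip, if_neg h]

/-- States of the canonical model. -/
abbrev St := {l : Node A // Valid X₀ l}

abbrev Vote := Set A × Fm A × Option (St X₀)

def Mech (w : St X₀) (s : A → Vote X₀) (u : St X₀) : Prop :=
  (∀ ψ, .strat ∅ ψ ∈ (hd X₀ w.1).car → ψ ∈ (hd X₀ u.1).car) ∧
  (∀ D ψ, D.Nonempty → .strat D ψ ∈ (hd X₀ w.1).car → (∀ a ∈ D, s a = (D, ψ, some w)) →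
    ψ ∈ (hd X₀ u.1).car) ∧
  (∀ D ψ, D.Nonempty → .how D ψ ∈ (hd X₀ w.1).car → (∀ a ∈ D, s a = (D, ψ, none)) →
    ψ ∈ (hd X₀ u.1).car)

theorem K_sim {C : Set A} {φ : Fm A} (w w' : St X₀)
    (h : ∀ a ∈ C, strip {a} w.1 = strip {a} w'.1) :
    .know C φ ∈ (hd X₀ w.1).car ↔ .know C φ ∈ (hd X₀ w'.1).car := by
  rw [K_strip X₀ w.1 w.2, K_strip X₀ w'.1 w'.2, strip_eq h]

theorem H_sim {C : Set A} {φ : Fm A} (w w' : St X₀)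
    (h : ∀ a ∈ C, strip {a} w.1 = strip {a} w'.1)
    (h1 : .how C φ ∈ (hd X₀ w.1).car) : .how C φ ∈ (hd X₀ w'.1).car :=
  (hd X₀ w'.1).mp' Prov.truth
    ((K_sim X₀ w w' h).1 ((hd X₀ w.1).posIntro Prov.stratNegIntro h1))

/-- child node -/
def child (w : St X₀) (C : Set A) (Y : MCS A)
    (h : ∀ φ, .know C φ ∈ (hd X₀ w.1).car → φ ∈ Y.car) (n : ℕ) : St X₀ :=
  ⟨(C, Y, n) :: w.1, w.2, h⟩

theorem child_sim (w : St X₀) {C : Set A} (Y : MCS A)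
    (h : ∀ φ, .know C φ ∈ (hd X₀ w.1).car → φ ∈ Y.car) (n : ℕ) :
    ∀ a ∈ C, strip {a} w.1 = strip {a} (child X₀ w C Y h n).1 := by
  intro a ha
  simp [child, strip, ha]

/-- Any set reachable via `S_∅` occurs as the head of a state. -/
theorem reach (w : St X₀) (Z : MCS A)
    (h : ∀ χ, .strat ∅ χ ∈ (hd X₀ w.1).car → χ ∈ Z.car) :
    ∃ u : St X₀, hd X₀ u.1 = Z := by
  refine ⟨child X₀ ⟨[], trivial⟩ ∅ Z ?_ 0, rfl⟩
  intro φ hφ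
  apply h
  have h1 : .know ∅ φ ∈ (hd X₀ w.1).car := (K_sim X₀ ⟨[], trivial⟩ w (by simp)).1 hφ
  exact MCS.mp' _ Prov.stratTruth (MCS.mp' _ Prov.emptyCoal h1)

open Classical in
/-- Extend a coalition strategy by ineffective votes. -/
noncomputable def extend (C : Set A) (s : C → Vote X₀) (a : A) : Vote X₀ :=
  if h : a ∈ C then s ⟨a, h⟩ else (∅, Formula.bot, none)

theorem extend_spec (C : Set A) (s : C → Vote X₀) (a : A) (h : a ∈ C) :
    extend X₀ C s a = s ⟨a, h⟩ := by simp [extend, h]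

theorem extend_out (C : Set A) (s : C → Vote X₀) (a : A) (h : a ∉ C) :
    (extend X₀ C s a).1 = ∅ := by simp [extend, h]

variable [Fintype A]

/-- The finite list of effective votes. -/
theorem active {X : MCS A} (box : Set A → Fm A → Fm A) (s : A → Vote X₀) (C : Set A)
    (hs : ∀ a, a ∉ C → (s a).1 = ∅) :
    ∃ L : List (Set A × Fm A), L.Pairwise (fun p q => Disjoint p.1 q.1) ∧
      (∀ p ∈ L, p.1 ⊆ C ∧ box p.1 p.2 ∈ X.car) ∧
      (∀ D ψ o, D.Nonempty → box D ψ ∈ X.car → (∀ a ∈ D, s a = (D, ψ, o)) → (D, ψ) ∈ L) := by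
  classical
  let P : Set (Set A × Fm A) :=
    {p | p.1.Nonempty ∧ box p.1 p.2 ∈ X.car ∧ ∃ o, ∀ a ∈ p.1, s a = (p.1, p.2, o)}
  have hinj : ∀ p ∈ P, ∀ q ∈ P, ¬ Disjoint p.1 q.1 → p = q := by
    rintro p ⟨_, _, o, hp⟩ q ⟨_, _, o', hq⟩ hd
    obtain ⟨a, h1, h2⟩ := Set.not_disjoint_iff.1 hd
    have := (hp a h1).symm.trans (hq a h2)
    simp only [Prod.mk.injEq] at this
    exact Prod.ext this.1 this.2.1
  have hfin : P.Finite := by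
    refine Set.Finite.of_finite_image (f := Prod.fst) (Set.toFinite _) ?_
    intro p hp q hq h
    apply hinj p hp q hq
    obtain ⟨a, ha⟩ := hp.1
    exact Set.not_disjoint_iff.2 ⟨a, ha, h ▸ ha⟩
  have hmem : ∀ p, p ∈ hfin.toFinset.toList ↔ p ∈ P := by simp
  refine ⟨hfin.toFinset.toList, ?_, ?_, ?_⟩
  · refine (List.Pairwise.imp_of_mem ?_ (Finset.nodup_toList _))
    intro p q hp hq hne
    by_contra hd
    exact hne (hinj p ((hmem p).1 hp) q ((hmem q).1 hq) hd)
  · intro p hp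
    obtain ⟨h1, h2, o, h3⟩ := (hmem p).1 hp
    refine ⟨?_, h2⟩
    intro a ha
    by_contra hc
    have := hs a hc
    rw [h3 a ha] at this
    exact h1.ne_empty this
  · intro D ψ o h1 h2 h3
    exact (hmem _).2 ⟨h1, h2, o, h3⟩

theorem S_fail (w : St X₀) (s : A → Vote X₀) (C : Set A) (hs : ∀ a, a ∉ C → (s a).1 = ∅)
    {φ : Fm A} (h : .strat C φ ∉ (hd X₀ w.1).car) :
    ∃ u, Mech X₀ w s u ∧ φ ∉ (hd X₀ u.1).car := by
  obtain ⟨L, h1, h2, h3⟩ := active X₀ (X := hd X₀ w.1) Formula.strat s C hs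
  have h4 : Formula.strat ∅ (imps (L.map Prod.snd) φ) ∉ (hd X₀ w.1).car := by
    intro hc
    exact h ((MCS.boxS _).list L ∅ (by simp) h1
      (fun p hp => ⟨(h2 p hp).1, (h2 p hp).2, by simp⟩) hc)
  obtain ⟨Z, h5, h6⟩ := (hd X₀ w.1).S_ext h4
  obtain ⟨u, rfl⟩ := reach X₀ w Z h5
  rw [MCS.imps_mem] at h6
  push Not at h6
  have h7 : ∀ p ∈ L, p.2 ∈ (hd X₀ u.1).car := fun p hp =>
    h6.1 _ (List.mem_map_of_mem hp)
  refine ⟨u, ⟨h5, ?_, ?_⟩, h6.2⟩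
  · intro D ψ a b c
    exact h7 (D, ψ) (h3 D ψ _ a b c)
  · intro D ψ a b c
    exact h7 (D, ψ) (h3 D ψ _ a (MCS.mp' _ Prov.stratTruth b) c)

theorem H_fail (w : St X₀) (s : A → Vote X₀) (C : Set A) (hs : ∀ a, a ∉ C → (s a).1 = ∅)
    {φ : Fm A} (h : .how C φ ∉ (hd X₀ w.1).car) :
    ∃ w' u, (∀ a ∈ C, strip {a} w.1 = strip {a} w'.1) ∧ Mech X₀ w' s u ∧
      φ ∉ (hd X₀ u.1).car := by
  obtain ⟨L, h1, h2, h3⟩ := active X₀ (X := hd X₀ w.1) Formula.how s C hs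
  set Θ := imps (L.map Prod.snd) φ with hΘ
  have h4 : Formula.know C (.strat ∅ Θ) ∉ (hd X₀ w.1).car := by
    intro hc
    have h5 : Formula.how C (.imp Θ φ) ∈ (hd X₀ w.1).car := by
      refine (MCS.boxH _).list L ∅ (by simp) h1
        (fun p hp => ⟨(h2 p hp).1, (h2 p hp).2, by simp⟩) ?_
      apply (MCS.boxH _).nec
      apply Prov.taut
      intro v hn hi
      simp only [hΘ, imps_val v hi, hi]
      tauto
    exact h ((MCS.imp _ _ _).1 (MCS.mp' _ Prov.epDet h5) hc)
  obtain ⟨Y, h5, h6⟩ := (hd X₀ w.1).K_ext h4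
  obtain ⟨n, hn⟩ : ∃ n, ∀ a, (s a).2.2 ≠ some (child X₀ w C Y h5 n) := by
    have hinj : Function.Injective (fun n => some (child X₀ w C Y h5 n)) := by
      intro m n hmn
      have h0 : (child X₀ w C Y h5 m).1 = (child X₀ w C Y h5 n).1 :=
        congrArg Subtype.val (Option.some.inj hmn)
      simpa [child] using h0
    have : ((fun n => some (child X₀ w C Y h5 n)) ⁻¹' (Set.range fun a => (s a).2.2)).Finite :=
      (Set.finite_range _).preimage hinj.injOn
    obtain ⟨n, hn⟩ := this.exists_notMem
    exact ⟨n, fun a ha => hn ⟨a, ha⟩⟩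
  have hsim := child_sim X₀ w Y h5 n
  obtain ⟨Z, h7, h8⟩ := Y.S_ext h6
  obtain ⟨u, rfl⟩ := reach X₀ (child X₀ w C Y h5 n) Z h7
  rw [hΘ, MCS.imps_mem] at h8
  push Not at h8
  refine ⟨child X₀ w C Y h5 n, u, hsim, ⟨h7, ?_, ?_⟩, h8.2⟩
  · rintro D ψ ⟨a, ha⟩ b c
    exact absurd (by rw [c a ha]) (hn a)
  · intro D ψ a b c
    have hDC : D ⊆ C := by
      intro x hx
      by_contra hc
      have := hs x hc
      rw [c x hx] at this
      exact a.ne_empty this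
    have hb := H_sim X₀ _ w (fun x hx => (hsim x (hDC hx)).symm) b
    exact h8.1 _ (List.mem_map_of_mem (f := Prod.snd) (h3 D ψ _ a hb c))

/-- The canonical model. -/
noncomputable def canon : ETS A ℕ where
  W := St X₀
  Sim a w w' := strip {a} w.1 = strip {a} w'.1
  sim_equiv a := ⟨fun _ => rfl, fun h => h.symm, fun h h' => h.trans h'⟩
  V := Vote X₀
  V_nonempty := ⟨(∅, Formula.bot, none)⟩
  M := Mech X₀
  M_serial w s := by
    obtain ⟨u, h, _⟩ := S_fail X₀ w s Set.univ (by simp) (φ := Formula.bot)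
      (((hd X₀ w.1).neg _).1 ((hd X₀ w.1).thm Prov.nonterm))
    exact ⟨u, h⟩
  pi p := {w | .var p ∈ (hd X₀ w.1).car}

theorem truth (φ : Fm A) : ∀ w : St X₀,
    (canon X₀).Sat w φ ↔ φ ∈ (hd X₀ w.1).car := by
  induction φ with
  | var p => intro w; exact Iff.rfl
  | neg φ ih => intro w; rw [MCS.neg, ← ih w]; exact Iff.rfl
  | imp φ ψ ih1 ih2 => intro w; rw [MCS.imp, ← ih1 w, ← ih2 w]; exact Iff.rfl
  | know C φ ih =>
    intro w
    constructor
    · intro h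
      by_contra hc
      obtain ⟨Y, h1, h2⟩ := (hd X₀ w.1).K_ext hc
      exact h2 ((ih (child X₀ w C Y h1 0)).1 (h _ (child_sim X₀ w Y h1 0)))
    · intro h w' hw
      exact (ih w').2 (MCS.mp' _ Prov.truth ((K_sim X₀ w w' hw).1 h))
  | strat C φ ih =>
    intro w
    constructor
    · rintro ⟨s, hs⟩
      by_contra hc
      obtain ⟨u, h1, h2⟩ := S_fail X₀ w (extend X₀ C s) C (extend_out X₀ C s) hc
      exact h2 ((ih u).1 (hs u ⟨_, extend_spec X₀ C s, h1⟩))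
    · intro h
      refine ⟨fun _ => (C, φ, some w), ?_⟩
      rintro u ⟨s', h1, h2⟩
      refine (ih u).2 ?_
      rcases C.eq_empty_or_nonempty with rfl | hC
      · exact h2.1 _ h
      · exact h2.2.1 C φ hC h h1
  | how C φ ih =>
    intro w
    constructor
    · rintro ⟨s, hs⟩
      by_contra hc
      obtain ⟨w', u, h0, h1, h2⟩ := H_fail X₀ w (extend X₀ C s) C (extend_out X₀ C s) hc
      exact h2 ((ih u).1 (hs w' u h0 ⟨_, extend_spec X₀ C s, h1⟩))
    · intro h
      refine ⟨fun _ => (C, φ, none), ?_⟩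
      rintro w' u hw ⟨s', h1, h2⟩
      have h' := H_sim X₀ w w' hw h
      refine (ih u).2 ?_
      rcases C.eq_empty_or_nonempty with rfl | hC
      · exact h2.1 _ (MCS.mp' _ Prov.stratTruth h')
      · exact h2.2.2 C φ hC h' h1

end

end KH

/-- Completeness: if `w ⊨ φ` in every state `w` of every
epistemic transition system, then `⊢ φ`. -/
theorem completeness {A : Type} [Fintype A] (φ : Formula A ℕ)
    (h : ∀ (T : ETS A ℕ) (w : T.W), T.Sat w φ) :
    Prov φ := by
  by_contra hp
  have hd : ¬ KH.Der ∅ φ := by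
    rintro ⟨L, a, b⟩
    cases L with
    | nil => exact hp b
    | cons x L => exact a x List.mem_cons_self
  obtain ⟨X, -, hX⟩ := KH.lindenbaum hd
  exact hX ((KH.truth X φ ⟨[], trivial⟩).1 (h (KH.canon X) _))
end

section
/- Validity of Strategic Negative Introspection: in every epistemic transition system, for every state w, every coalition C, and every formula φ, if w ⊨ ¬H_C φ then w ⊨ K_C ¬H_C φ. -/
variable {A Var : Type}

/-- validity of Strategic Negative Introspection:
if `w ⊨ ¬H_C φ` then `w ⊨ K_C ¬H_C φ`. -/
theorem strategic_negative_introspection_valid {A Var : Type} [Fintype A]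
    (T : ETS A Var) (w : T.W) (C : Set A) (φ : Formula A Var)
    (h : T.Sat w (.neg (.how C φ))) :
    T.Sat w (.know C (.neg (.how C φ))) := by
  simp only [ETS.Sat] at h ⊢
  rintro u hu ⟨s, hs⟩
  exact h ⟨s, fun w' w'' hw ht => hs w' w''
    (fun a ha => (T.sim_equiv a).trans ((T.sim_equiv a).symm (hu a ha)) (hw a ha)) ht⟩
end

section
/- Validity of Strategic Positive Introspection: in every epistemic transition system, for every state w, every coalition C, and every formula φ, if w ⊨ H_C φ then w ⊨ K_C H_C φ. -/
variable {A Var : Type}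

/-- validity of Strategic Positive Introspection:
if `w ⊨ H_C φ` then `w ⊨ K_C H_C φ`. -/
theorem strategic_positive_introspection_valid {A Var : Type} [Fintype A]
    (T : ETS A Var) (w : T.W) (C : Set A) (φ : Formula A Var)
    (h : T.Sat w (.how C φ)) :
    T.Sat w (.know C (.how C φ)) := by
  simp only [ETS.Sat] at h ⊢
  obtain ⟨s, hs⟩ := h
  intro u hu
  exact ⟨s, fun w' w'' h1 h2 =>
    hs w' w'' (fun a ha => (T.sim_equiv a).trans (hu a ha) (h1 a ha)) h2⟩
end

section
/- Validity of Cooperation: in every epistemic transition system, for every state w, all disjoint coalitions C and D (C ∩ D = ∅), and all formulas φ, ψ: if w ⊨ S_C(φ → ψ) and w ⊨ S_D φ, then w ⊨ S_{C∪D} ψ. -/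
variable {A Var : Type}

/-- validity of Cooperation: for disjoint coalitions `C`, `D`,
if `w ⊨ S_C (φ → ψ)` and `w ⊨ S_D φ` then `w ⊨ S_{C ∪ D} ψ`. -/
theorem cooperation_valid {A Var : Type} [Fintype A]
    (T : ETS A Var) (w : T.W) (C D : Set A) (hdisj : C ∩ D = ∅)
    (φ ψ : Formula A Var)
    (h1 : T.Sat w (.strat C (.imp φ ψ))) (h2 : T.Sat w (.strat D φ)) :
    T.Sat w (.strat (C ∪ D) ψ) := by 
  classical
  simp only [ETS.Sat] at h1 h2 ⊢
  obtain ⟨s, hs⟩ := h1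
  obtain ⟨t, ht⟩ := h2
  refine ⟨fun a => if hC : a.1 ∈ C then s ⟨a.1, hC⟩
    else t ⟨a.1, a.2.resolve_left hC⟩, ?_⟩
  rintro u ⟨r, hr, hM⟩
  refine hs u ⟨r, fun a ha => ?_, hM⟩ (ht u ⟨r, fun a ha => ?_, hM⟩)
  · exact (hr a (Or.inl ha)).trans (dif_pos ha)
  · have hC : a ∉ C := fun hC => by
      have hmem : a ∈ C ∩ D := ⟨hC, ha⟩
      rw [hdisj] at hmem
      exact hmem
    exact (hr a (Or.inr ha)).trans (dif_neg hC)
end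

section
/- Validity of Epistemic Cooperation: in every epistemic transition system, for every state w, all disjoint coalitions C and D (C ∩ D = ∅), and all formulas φ, ψ: if w ⊨ H_C(φ → ψ) and w ⊨ H_D φ, then w ⊨ H_{C∪D} ψ. -/
variable {A Var : Type}

/-- validity of Epistemic Cooperation: for disjoint coalitions
`C`, `D`, if `w ⊨ H_C (φ → ψ)` and `w ⊨ H_D φ` then `w ⊨ H_{C ∪ D} ψ`. -/
theorem epistemic_cooperation_valid {A Var : Type} [Fintype A]
    (T : ETS A Var) (w : T.W) (C D : Set A) (hdisj : C ∩ D = ∅)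
    (φ ψ : Formula A Var)
    (h1 : T.Sat w (.how C (.imp φ ψ))) (h2 : T.Sat w (.how D φ)) :
    T.Sat w (.how (C ∪ D) ψ) := by
  classical
  simp only [ETS.Sat] at h1 h2 ⊢
  obtain ⟨s₁, h1⟩ := h1
  obtain ⟨s₂, h2⟩ := h2
  refine ⟨fun a => if h : a.1 ∈ C then s₁ ⟨a.1, h⟩ else s₂ ⟨a.1, a.2.resolve_left h⟩, ?_⟩
  rintro w' w'' hs ⟨s', hs', hM⟩
  refine h1 w' w'' (fun a ha => hs a (Or.inl ha)) ⟨s', fun a ha => ?_, hM⟩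
    (h2 w' w'' (fun a ha => hs a (Or.inr ha)) ⟨s', fun a ha => ?_, hM⟩)
  · rw [hs' a (Or.inl ha)]
    exact dif_pos ha
  · have hn : a ∉ C := fun hc => by
      have hm : a ∈ C ∩ D := ⟨hc, ha⟩
      rw [hdisj] at hm
      exact hm
    rw [hs' a (Or.inr ha)]
    exact dif_neg hn
end

section
/- Validity of know-how monotonicity: in every epistemic transition system, for every state w, all coalitions C ⊆ D, and every formula φ, if w ⊨ H_C φ then w ⊨ H_D φ. -/
variable {A Var : Type}

/-- validity of know-how monotonicity: for coalitions `C ⊆ D`,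
if `w ⊨ H_C φ` then `w ⊨ H_D φ`. -/
theorem how_monotonicity_valid {A Var : Type} [Fintype A]
    (T : ETS A Var) (w : T.W) (C D : Set A) (hCD : C ⊆ D) (φ : Formula A Var)
    (h : T.Sat w (.how C φ)) :
    T.Sat w (.how D φ) := by
  classical
  simp only [ETS.Sat] at h ⊢
  obtain ⟨s, hs⟩ := h
  obtain ⟨v⟩ := T.V_nonempty
  refine ⟨fun a => if ha : a.1 ∈ C then s ⟨a.1, ha⟩ else v, ?_⟩
  rintro w' w'' hsim ⟨s', hs', hM⟩
  refine hs w' w'' (fun a ha => hsim a (hCD ha)) ⟨s', fun a ha => ?_, hM⟩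
  rw [hs' a (hCD ha)]
  exact dif_pos ha
end

section
/- Validity of Epistemic Determinicity: in every epistemic transition system, for every state w, every coalition C, and all formulas φ, ψ: if w ⊨ H_C(φ → ψ) and w ⊨ K_C S_∅ φ, then w ⊨ H_C ψ. -/
variable {A Var : Type}

/-- validity of Epistemic Determinicity:
if `w ⊨ H_C (φ → ψ)` and `w ⊨ K_C S_∅ φ`, then `w ⊨ H_C ψ`. -/
theorem epistemic_determinicity_valid {A Var : Type} [Fintype A]
    (T : ETS A Var) (w : T.W) (C : Set A) (φ ψ : Formula A Var)
    (h1 : T.Sat w (.how C (.imp φ ψ)))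
    (h2 : T.Sat w (.know C (.strat (∅ : Set A) φ))) :
    T.Sat w (.how C ψ) := by
  simp only [ETS.Sat] at h1 h2 ⊢
  obtain ⟨s, hs⟩ := h1
  refine ⟨s, fun w' w'' hw ht => ?_⟩
  obtain ⟨t, hφ⟩ := h2 w' hw
  refine hs w' w'' hw ht (hφ w'' ?_)
  obtain ⟨s', _, hM⟩ := ht
  exact ⟨s', fun a h => absurd h (Set.notMem_empty a), hM⟩
end
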